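/- arXiv:0911.3881 — 2 statements merged into one kernel-verified Lean document; each statement's English description precedes it below -/
import Mathlib

section
/- Let f(t) ∈ ℤ[t] be an irreducible nonconstant polynomial and let N = ℚ[t]/(f(t)), a number field. Suppose that N contains no primitive third root of unity, i.e., no element x ∈ N satisfies x² + x + 1 = 0. Then there are infinitely many rational primes p such that p ≡ 2 (mod 3) and such that there exists a prime ideal 𝔭 of the ring of integers of N lying over p with residue degree 1, i.e., [O_N/𝔭 : 𝔽_p] = 1. -/
open Polynomial NumberField

open IsDedekindDomain
open scoped ENNReal

/-- The sum over all finitely supported exponents `m` of the monomials `∏ i, w i ^ m i`, i.e. the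
expansion of the Euler product `∏ i, (1 - w i)⁻¹`. -/
noncomputable def eulerSum {ι : Type*} (w : ι → ℝ≥0∞) : ℝ≥0∞ :=
  ∑' m : ι →₀ ℕ, m.prod fun i n ↦ w i ^ n

section EulerSum

variable {ι κ : Type*}

theorem eulerSum_mono {v w : ι → ℝ≥0∞} (h : ∀ i, v i ≤ w i) : eulerSum v ≤ eulerSum w :=
  ENNReal.tsum_le_tsum fun _ ↦ Finset.prod_le_prod' fun i _ ↦ pow_le_pow_left' (h i) _

theorem eulerSum_le_of_injective {v : ι → ℝ≥0∞} {w : κ → ℝ≥0∞} (e : ι → κ)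
    (he : Function.Injective e) (h : ∀ i, v i ≤ w (e i)) : eulerSum v ≤ eulerSum w := by
  refine (eulerSum_mono h).trans ?_
  have key (m : ι →₀ ℕ) : (m.prod fun i n ↦ w (e i) ^ n) =
      (m.mapDomain e).prod fun i n ↦ w i ^ n :=
    (Finsupp.prod_mapDomain_index (h := fun i n ↦ w i ^ n)
      (fun _ ↦ pow_zero _) (fun _ _ _ ↦ pow_add _ _ _)).symm
  simp_rw [eulerSum, key]
  exact ENNReal.tsum_comp_le_tsum_of_injective (Finsupp.mapDomain_injective he) _

theorem eulerSum_sumElim (v : ι → ℝ≥0∞) (w : κ → ℝ≥0∞) :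
    eulerSum (Sum.elim v w) = eulerSum v * eulerSum w := by
  rw [eulerSum, ← Finsupp.sumFinsuppEquivProdFinsupp.symm.tsum_eq]
  have key (p : (ι →₀ ℕ) × (κ →₀ ℕ)) :
      ((Finsupp.sumFinsuppEquivProdFinsupp.symm p).prod fun i n ↦ Sum.elim v w i ^ n) =
      (p.1.prod fun i n ↦ v i ^ n) * (p.2.prod fun i n ↦ w i ^ n) :=
    Finsupp.prod_sumElim _ _ _
  simp_rw [key]
  rw [ENNReal.tsum_prod' (f := fun p : (ι →₀ ℕ) × (κ →₀ ℕ) ↦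
    (p.1.prod fun i n ↦ v i ^ n) * (p.2.prod fun i n ↦ w i ^ n))]
  simp_rw [ENNReal.tsum_mul_left, ENNReal.tsum_mul_right, eulerSum]

theorem eulerSum_ne_top {w : ι → ℝ≥0∞} (hw : ∀ i, w i ≤ 2⁻¹) (hsum : ∑' i, w i ≠ ∞) :
    eulerSum w ≠ ∞ := by
  obtain ⟨u, hu⟩ : ∃ u : ι × ℕ → NNReal, ∀ p, (u p : ℝ≥0∞) = w p.1 ^ (p.2 + 1) :=
    ⟨fun p ↦ (w p.1 ^ (p.2 + 1)).toNNReal, fun p ↦ ENNReal.coe_toNNReal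
      (ENNReal.pow_ne_top (ne_top_of_le_ne_top (by simp) (hw p.1)))⟩
  have husum : ∑' p, (u p : ℝ≥0∞) ≠ ∞ := by
    simp_rw [hu]
    rw [ENNReal.tsum_prod (f := fun i n ↦ w i ^ (n + 1))]
    have hle (i : ι) : ∑' n : ℕ, w i ^ (n + 1) ≤ w i * 2 := by
      simp_rw [pow_succ', ENNReal.tsum_mul_left, ENNReal.tsum_geometric]
      gcongr
      rw [ENNReal.inv_le_iff_inv_le]
      exact ENNReal.one_sub_inv_two.symm.le.trans (tsub_le_tsub_left (hw i) 1)
    refine ne_top_of_le_ne_top ?_ (ENNReal.tsum_le_tsum hle)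
    rw [ENNReal.tsum_mul_right]
    exact ENNReal.mul_ne_top hsum (by simp)
  have hfin : ∑' s : Finset (ι × ℕ), ∏ p ∈ s, (u p : ℝ≥0∞) ≠ ∞ := by
    have := summable_finsetProd_of_summable_nonneg (fun p ↦ (u p).2)
      (NNReal.summable_coe.2 (ENNReal.tsum_coe_ne_top_iff_summable.1 husum))
    simp_rw [← ENNReal.ofNNReal_finsetProd]
    refine ENNReal.tsum_coe_ne_top_iff_summable.2 (NNReal.summable_coe.1 ?_)
    simpa using this
  let g (m : ι →₀ ℕ) : Finset (ι × ℕ) :=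
    m.support.map ⟨fun i ↦ (i, m i - 1), fun i j h ↦ congrArg Prod.fst h⟩
  have hg_mem (m : ι →₀ ℕ) (i : ι) (n : ℕ) : (i, n) ∈ g m ↔ m i = n + 1 := by
    change _ ∈ m.support.map _ ↔ _
    simp only [Finset.mem_map, Finsupp.mem_support_iff]
    constructor
    · rintro ⟨j, hj, hji⟩
      obtain ⟨rfl, rfl⟩ := Prod.mk.inj hji
      lia
    · exact fun h ↦ ⟨i, by lia, Prod.ext rfl (by change m i - 1 = n; lia)⟩
  have hg : Function.Injective g := by
    intro m m' h
    ext i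
    have (n : ℕ) : m i = n + 1 ↔ m' i = n + 1 := by rw [← hg_mem, ← hg_mem, h]
    have h1 := this (m i - 1)
    have h2 := this (m' i - 1)
    lia
  have key (m : ι →₀ ℕ) : (m.prod fun i n ↦ w i ^ n) = ∏ p ∈ g m, (u p : ℝ≥0∞) := by
    rw [Finset.prod_map]
    refine Finset.prod_congr rfl fun i hi ↦ ?_
    have : m i ≠ 0 := by simpa using hi
    rw [hu]
    exact congrArg (w i ^ ·) (by change m i = m i - 1 + 1; lia)
  simp_rw [eulerSum, key]
  exact ne_top_of_le_ne_top hfin (ENNReal.tsum_comp_le_tsum_of_injective hg _)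

end EulerSum

section IdealWeight

variable {R : Type*} [CommRing R] [IsDedekindDomain R] [Module.Free ℤ R]

/-- The completely multiplicative function `I ↦ N(I) ^ (-s)`. -/
noncomputable def idealWeight (R : Type*) [CommRing R] [IsDedekindDomain R] [Module.Free ℤ R]
    (s : ℝ) : Ideal R →* ℝ≥0∞ where
  toFun I := ((I.absNorm : NNReal) ^ (-s) : NNReal)
  map_one' := by simp
  map_mul' I J := by simp [NNReal.mul_rpow]

theorem idealWeight_apply (s : ℝ) (I : Ideal R) :
    idealWeight R s I = ((I.absNorm : NNReal) ^ (-s) : NNReal) := rfl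

theorem idealWeight_bot [Infinite R] {s : ℝ} (hs : s ≠ 0) : idealWeight R s ⊥ = 0 := by
  simp [idealWeight_apply, hs]

theorem idealWeight_one (I : Ideal R) : idealWeight R 1 I = ((I.absNorm : NNReal)⁻¹ : NNReal) := by
  rw [idealWeight_apply, NNReal.rpow_neg_one]

theorem idealWeight_le_of_le {I : Ideal R} (hI : I.absNorm ≠ 0) {s t : ℝ} (h : s ≤ t) :
    idealWeight R t I ≤ idealWeight R s I := by
  rw [idealWeight_apply, idealWeight_apply, ENNReal.coe_le_coe]
  exact NNReal.rpow_le_rpow_of_exponent_le (mod_cast Nat.one_le_iff_ne_zero.2 hI) (by linarith)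

theorem idealWeight_le_of_absNorm_le {S : Type*} [CommRing S] [IsDedekindDomain S]
    [Module.Free ℤ S] {I : Ideal R} {J : Ideal S} (hJ : J.absNorm ≠ 0)
    (h : J.absNorm ≤ I.absNorm) {s : ℝ} (hs : 0 ≤ s) : idealWeight R s I ≤ idealWeight S s J := by
  rw [idealWeight_apply, idealWeight_apply, ENNReal.coe_le_coe, NNReal.rpow_neg, NNReal.rpow_neg]
  have : (0 : NNReal) < J.absNorm := by positivity
  gcongr

theorem tsum_idealWeight_eq_eulerSum [Infinite R] {s : ℝ} (hs : s ≠ 0) :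
    ∑' I : Ideal R, idealWeight R s I =
      eulerSum fun v : HeightOneSpectrum R ↦ idealWeight R s v.asIdeal := by
  classical
  let e (m : HeightOneSpectrum R →₀ ℕ) : Ideal R :=
    ((Finsupp.toMultiset m).map HeightOneSpectrum.asIdeal).prod
  have key (m : HeightOneSpectrum R →₀ ℕ) :
      (m.prod fun v n ↦ idealWeight R s v.asIdeal ^ n) = idealWeight R s (e m) := by
    rw [map_multiset_prod, Multiset.map_map, Finsupp.toMultiset_map, Finsupp.prod_toMultiset,
      Finsupp.prod_mapDomain_index (fun _ ↦ pow_zero _) (fun _ _ _ ↦ pow_add _ _ _)]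
    rfl
  have he : Function.Injective e := by
    intro m m' h
    have hfac (m) : UniqueFactorizationMonoid.normalizedFactors (e m) =
        (Finsupp.toMultiset m).map HeightOneSpectrum.asIdeal := by
      refine UniqueFactorizationMonoid.normalizedFactors_prod_of_prime fun I hI ↦ ?_
      obtain ⟨v, -, rfl⟩ := Multiset.mem_map.1 hI
      exact v.prime
    refine Multiset.toFinsupp.symm.injective
      (Multiset.map_injective (fun v w h ↦ HeightOneSpectrum.ext h) ?_)
    exact (hfac m).symm.trans ((congrArg _ h).trans (hfac m'))
  simp_rw [eulerSum, key]
  refine (he.tsum_eq fun I hI ↦ ?_).symm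
  have hI0 : I ≠ ⊥ := by
    rintro rfl
    exact hI (idealWeight_bot hs)
  have hmem : ∀ J ∈ UniqueFactorizationMonoid.normalizedFactors I,
      J ∈ Set.range (HeightOneSpectrum.asIdeal (R := R)) := fun J hJ ↦
    have := UniqueFactorizationMonoid.prime_of_normalized_factor J hJ
    ⟨⟨J, Ideal.isPrime_of_prime this, this.ne_zero⟩, rfl⟩
  have : CanLift (Ideal R) (HeightOneSpectrum R) HeightOneSpectrum.asIdeal
    (· ∈ Set.range HeightOneSpectrum.asIdeal) := ⟨fun _ hJ ↦ hJ⟩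
  obtain ⟨t, ht⟩ := (Multiset.canLift (HeightOneSpectrum.asIdeal (R := R)) _).prf _ hmem
  refine ⟨Multiset.toFinsupp t, ?_⟩
  rw [← Ideal.prod_normalizedFactors_eq_self hI0, ← ht]
  simp [e]

end IdealWeight

section Zeta

variable {K : Type*} [Field K] [NumberField K]

theorem tsum_idealWeight_eq_ofReal_norm_dedekindZeta {s : ℝ} (hs : s ≠ 0)
    (h : dedekindZeta K s ≠ 0) :
    ∑' I : Ideal (𝓞 K), idealWeight (𝓞 K) s I = ENNReal.ofReal ‖dedekindZeta K s‖ := by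
  let a (n : ℕ) : ℕ := Nat.card {I : Ideal (𝓞 K) // I.absNorm = n}
  let g (n : ℕ) : NNReal := a n * (n : NNReal) ^ (-s)
  have hterm (n : ℕ) : LSeries.term (fun n ↦ (a n : ℂ)) s n = ((g n : ℝ) : ℂ) := by
    rcases eq_or_ne n 0 with rfl | hn
    · simp [g, hs]
    · rw [LSeries.term_of_ne_zero hn]
      simp [g, div_eq_mul_inv, Complex.ofReal_cpow, Real.rpow_neg]
  have hzeta : dedekindZeta K s = ((∑' n, g n : NNReal) : ℝ) := by
    rw [dedekindZeta, LSeries]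
    push_cast
    exact tsum_congr hterm
  have hsum : Summable g := by
    by_contra hg
    exact h (by rw [hzeta, tsum_eq_zero_of_not_summable hg]; simp)
  have hfiber (n : ℕ) : ∑' I : {I : Ideal (𝓞 K) // I.absNorm = n}, idealWeight (𝓞 K) s I = g n := by
    have hfin : Finite {I : Ideal (𝓞 K) // I.absNorm = n} :=
      (Ideal.finite_setOfPred_absNorm_eq n).to_subtype
    have (I : {I : Ideal (𝓞 K) // I.absNorm = n}) :
        idealWeight (𝓞 K) s I = ((n : NNReal) ^ (-s) : NNReal) := by
      rw [idealWeight_apply, I.2]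
    simp_rw [this, ENNReal.tsum_const, ENat.card_eq_coe_natCard]
    simp [g, a]
  rw [← (Equiv.sigmaFiberEquiv (Ideal.absNorm (S := 𝓞 K))).tsum_eq, ENNReal.tsum_sigma']
  rw [hzeta]
  simp only [Complex.norm_real, Real.norm_eq_abs, NNReal.abs_eq, ENNReal.ofReal_coe_nnreal]
  rw [ENNReal.coe_tsum hsum]
  exact tsum_congr hfiber

end Zeta

theorem exists_dvd_sq_add_self_add_one {p : ℕ} (hp : p.Prime) (h : p % 3 = 1) :
    ∃ a : ℤ, (p : ℤ) ∣ a ^ 2 + a + 1 := by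
  have : Fact p.Prime := ⟨hp⟩
  have hcard : 3 ∣ Fintype.card (ZMod p)ˣ := by
    rw [ZMod.card_units_eq_totient, Nat.totient_prime hp]
    lia
  obtain ⟨u, hu⟩ := exists_prime_orderOf_dvd_card 3 hcard
  have hu3 : (u : ZMod p) ^ 3 = 1 := by
    rw [← Units.val_pow_eq_pow_val, ← hu, pow_orderOf_eq_one, Units.val_one]
  have hu1 : (u : ZMod p) - 1 ≠ 0 := by
    rw [sub_ne_zero, Ne, Units.val_eq_one]
    rintro rfl
    simp at hu
  refine ⟨(u : ZMod p).val, (ZMod.intCast_zmod_eq_zero_iff_dvd _ _).1 ?_⟩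
  push_cast
  rw [ZMod.natCast_zmod_val]
  refine (mul_eq_zero_iff_left hu1).1 ?_
  linear_combination hu3

theorem cyclotomic_three_irreducible_of_forall_ne {K : Type*} [Field K]
    (h : ∀ z : K, z ^ 2 + z + 1 ≠ 0) : Irreducible (cyclotomic 3 K) := by
  have hdeg : (cyclotomic 3 K).natDegree = 2 := by
    rw [natDegree_cyclotomic]; decide
  refine (irreducible_iff_roots_eq_zero_of_degree_le_three hdeg.ge (by lia)).2 ?_
  refine Multiset.eq_zero_of_forall_notMem fun z hz ↦ h z ?_
  simpa [cyclotomic_three] using (mem_roots'.1 hz).2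

/-- If `K` contains no primitive cube root of unity `ζ`, the nontrivial automorphism of `K(ζ)`. -/
theorem exists_algEquiv_apply_zeta_three {K L : Type*} [Field K] [NumberField K] [Field L]
    [Algebra K L] [IsCyclotomicExtension {3} K L]
    (h : Irreducible (cyclotomic 3 K)) {ζ : L} (hζ : IsPrimitiveRoot ζ 3) :
    ∃ σ : L ≃ₐ[K] L, σ ζ = -1 - ζ := by
  have hsq {x : L} (hx : IsPrimitiveRoot x 3) : x ^ 2 + x + 1 = 0 := by
    simpa [cyclotomic_three] using hx.isRoot_cyclotomic (by simp)
  have := IsCyclotomicExtension.isGalois {3} K L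
  have := IsCyclotomicExtension.finiteDimensional {3} K L
  have hcard : Nat.card (L ≃ₐ[K] L) = 2 := by
    rw [IsGalois.card_aut_eq_finrank, IsCyclotomicExtension.finrank L h]
    decide
  have : Nontrivial (L ≃ₐ[K] L) := Finite.one_lt_card_iff_nontrivial.1 (by lia)
  obtain ⟨σ, hσ⟩ := exists_ne (1 : L ≃ₐ[K] L)
  have hne : σ ζ - ζ ≠ 0 := by
    refine fun h0 ↦ hσ (AlgEquiv.coe_toAlgHom_injective ?_)
    refine (hζ.powerBasis K).algHom_ext ?_
    simpa using sub_eq_zero.1 h0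
  refine ⟨σ, ?_⟩
  have h1 := hsq hζ
  have h2 := hsq (hζ.map_of_injective σ.injective)
  have := (mul_eq_zero_iff_left hne).1
    (show (σ ζ - ζ) * (σ ζ + ζ + 1) = 0 by linear_combination h2 - h1)
  linear_combination this

theorem exists_pair_of_absNorm_mod_three {K L : Type*} [Field K] [NumberField K] [Field L]
    [NumberField L] [Algebra K L] [IsCyclotomicExtension {3} K L]
    (h : Irreducible (cyclotomic 3 K)) (P : HeightOneSpectrum (𝓞 K))
    (hP : P.asIdeal.absNorm.Prime) (hP3 : P.asIdeal.absNorm % 3 = 1) :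
    ∃ Q Q' : HeightOneSpectrum (𝓞 L), Q ≠ Q' ∧
      (Q.asIdeal.under (𝓞 K) = P.asIdeal ∧ Q.asIdeal.absNorm ≤ P.asIdeal.absNorm) ∧
      (Q'.asIdeal.under (𝓞 K) = P.asIdeal ∧ Q'.asIdeal.absNorm ≤ P.asIdeal.absNorm) := by
  obtain ⟨a, ha⟩ := exists_dvd_sq_add_self_add_one hP hP3
  have hζ := IsCyclotomicExtension.zeta_spec 3 K L
  obtain ⟨σ, hσ⟩ := exists_algEquiv_apply_zeta_three h hζ
  obtain ⟨z, hz⟩ : ∃ z : 𝓞 L, algebraMap (𝓞 L) L z = IsCyclotomicExtension.zeta 3 K L :=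
    ⟨hζ.toInteger, rfl⟩
  let τ : 𝓞 L ≃ₐ[𝓞 K] 𝓞 L := RingOfIntegers.mapAlgEquiv σ
  have hτ : τ z = -1 - z := RingOfIntegers.ext (by
    rw [← hz] at hσ
    change σ (algebraMap (𝓞 L) L z) = algebraMap (𝓞 L) L (-1 - z)
    simpa using hσ)
  have hzz : z ^ 2 + z + 1 = 0 := by
    refine RingOfIntegers.ext ?_
    rw [← hz] at hζ
    simpa [cyclotomic_three] using hζ.isRoot_cyclotomic (by simp)
  have := P.isPrime
  obtain ⟨Q, hQmax, hQover⟩ :=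
    Ideal.exists_maximal_ideal_liesOver_of_isIntegral (S := 𝓞 L) P.asIdeal
  have hQP : Q.under (𝓞 K) = P.asIdeal := hQover.over.symm
  have hmapQ : P.asIdeal.map (algebraMap (𝓞 K) (𝓞 L)) ≤ Q := Ideal.map_le_iff_le_comap.2 hQP.ge
  let Q' : Ideal (𝓞 L) := Q.comap τ
  have hQ'max : Q'.IsMaximal := Ideal.comap_isMaximal_of_equiv τ
  have hQ'P : Q'.under (𝓞 K) = P.asIdeal := by
    rw [← hQP]
    ext x
    simp [Q', Ideal.mem_comap, Ideal.under]
  have hmapQ' : P.asIdeal.map (algebraMap (𝓞 K) (𝓞 L)) ≤ Q' := Ideal.map_le_iff_le_comap.2 hQ'P.ge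
  have hpQ : ((P.asIdeal.absNorm : ℤ) : 𝓞 L) ∈ Q := by
    have := hmapQ (Ideal.mem_map_of_mem _ (Ideal.absNorm_mem P.asIdeal))
    simpa using this
  have hQQ' : Q ≠ Q' := by
    intro heq
    have hmem (x : 𝓞 L) : x ∈ Q ↔ τ x ∈ Q := by
      conv_lhs => rw [heq]
      exact Ideal.mem_comap
    have hprod : (z - a) * (-1 - z - a) ∈ Q := by
      obtain ⟨b, hb⟩ := ha
      have : (z - a) * (-1 - z - a) = (P.asIdeal.absNorm : ℤ) * (b : 𝓞 L) := by
        rw [← Int.cast_mul, ← hb]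
        push_cast
        linear_combination -hzz
      rw [this]
      exact Q.mul_mem_right _ hpQ
    have hiff : z - a ∈ Q ↔ -1 - z - a ∈ Q := by
      rw [hmem, map_sub, hτ, map_intCast]
    have hboth : z - a ∈ Q ∧ -1 - z - a ∈ Q := by
      have := hQmax.isPrime.mem_or_mem hprod
      tauto
    have h3 : ((3 : ℤ) : 𝓞 L) ∈ Q := by
      have := Q.mul_mem_left (-(2 * z + 1)) (Q.sub_mem hboth.1 hboth.2)
      convert this using 1
      push_cast
      linear_combination 4 * hzz
    have hcop : IsCoprime (3 : ℤ) (P.asIdeal.absNorm : ℤ) := by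
      refine Nat.isCoprime_iff_coprime.2 ((Nat.coprime_primes Nat.prime_three hP).2 ?_)
      intro h3
      rw [← h3] at hP3
      lia
    obtain ⟨u, v, huv⟩ := hcop
    refine hQmax.ne_top (Q.eq_top_iff_one.2 ?_)
    have := Q.add_mem (Q.mul_mem_left (u : 𝓞 L) h3) (Q.mul_mem_left (v : 𝓞 L) hpQ)
    rwa [← Int.cast_mul, ← Int.cast_mul, ← Int.cast_add, huv, Int.cast_one] at this
  have hnorm : Q'.absNorm = Q.absNorm := by
    rw [Ideal.absNorm_apply, Ideal.absNorm_apply, Submodule.cardQuot_apply,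
      Submodule.cardQuot_apply]
    exact Nat.card_congr (Ideal.quotientEquiv Q' Q τ
      (Ideal.map_comap_of_surjective _ τ.surjective _).symm).toEquiv
  have hfinrank : Module.finrank (𝓞 K) (𝓞 L) = 2 := by
    rw [← IsFractionRing.finrank_eq (𝓞 K) K (𝓞 L) L, IsCyclotomicExtension.finrank L h]
    decide
  have hle : Q.absNorm ≤ P.asIdeal.absNorm := by
    have hmul : P.asIdeal.map (algebraMap (𝓞 K) (𝓞 L)) ≤ Q * Q' := by
      rw [Ideal.mul_eq_inf_of_coprime
        (Ideal.isCoprime_iff_sup_eq.1 (Ideal.isCoprime_of_isMaximal hQQ'))]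
      exact le_inf hmapQ hmapQ'
    have := Ideal.absNorm_dvd_absNorm_of_le hmul
    rw [Ideal.absNorm_algebraMap, hfinrank, map_mul, hnorm, ← sq] at this
    exact Nat.le_of_dvd hP.pos ((Nat.pow_dvd_pow_iff two_ne_zero).1 this)
  have hne {I : Ideal (𝓞 L)} (hI : I.under (𝓞 K) = P.asIdeal) : I ≠ ⊥ := by
    rintro rfl
    exact P.ne_bot (by rw [← hI]; exact Ideal.under_bot _ _)
  exact ⟨⟨Q, hQmax.isPrime, hne hQP⟩, ⟨Q', hQ'max.isPrime, hne hQ'P⟩,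
    fun h ↦ hQQ' (congrArg HeightOneSpectrum.asIdeal h), ⟨hQP, hle⟩, ⟨hQ'P, hnorm.trans_le hle⟩⟩

section BadPrimes

variable {K : Type*} [Field K] [NumberField K]

theorem card_le_finrank_of_natCast_mem {p : ℕ} (hp : p.Prime) (s : Finset (HeightOneSpectrum (𝓞 K)))
    (hs : ∀ P ∈ s, (p : 𝓞 K) ∈ P.asIdeal) : s.card ≤ Module.finrank ℚ K := by
  classical
  have hdvd : ∏ P ∈ s, P.asIdeal ∣ Ideal.span {(p : 𝓞 K)} := by
    rw [← Finset.prod_image (f := fun I ↦ I) (g := HeightOneSpectrum.asIdeal)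
      fun P _ Q _ h ↦ HeightOneSpectrum.ext h]
    refine Finset.prod_primes_dvd _ ?_ ?_
    · simp only [Finset.forall_mem_image]
      exact fun P _ ↦ P.prime
    · simp only [Finset.forall_mem_image]
      exact fun P hP ↦ Ideal.dvd_span_singleton.2 (hs P hP)
  have hnorm : Ideal.absNorm (Ideal.span {(p : 𝓞 K)}) = p ^ Module.finrank ℚ K := by
    rw [Ideal.absNorm_span_natCast, RingOfIntegers.rank]
  have hpdvd : ∀ P ∈ s, p ∣ P.asIdeal.absNorm := fun P hP ↦ by
    have h := map_dvd Ideal.absNorm (Ideal.dvd_span_singleton.2 (hs P hP))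
    rw [hnorm] at h
    obtain ⟨k, -, hk⟩ := (Nat.dvd_prime_pow hp).1 h
    rw [hk]
    refine dvd_pow_self p ?_
    rintro rfl
    exact P.isPrime.ne_top (Ideal.absNorm_eq_one_iff.1 (by simpa using hk))
  have h := map_dvd Ideal.absNorm hdvd
  rw [hnorm, map_prod] at h
  have h' := (Finset.prod_dvd_prod_of_dvd _ _ hpdvd).trans h
  rw [Finset.prod_const] at h'
  exact (Nat.pow_dvd_pow_iff_le_right hp.one_lt).1 h'

theorem absNorm_ne_zero (P : HeightOneSpectrum (𝓞 K)) : P.asIdeal.absNorm ≠ 0 :=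
  mt Ideal.absNorm_eq_zero_iff.1 P.ne_bot

theorem tsum_idealWeight_one_ne_top_of_not_prime :
    ∑' P : {P : HeightOneSpectrum (𝓞 K) // ¬ P.asIdeal.absNorm.Prime},
      idealWeight (𝓞 K) 1 P.1.asIdeal ≠ ∞ := by
  have hex (P : {P : HeightOneSpectrum (𝓞 K) // ¬ P.asIdeal.absNorm.Prime}) :
      ∃ p : ℕ, p.Prime ∧ (p : 𝓞 K) ∈ P.1.asIdeal ∧ p ^ 2 ≤ P.1.asIdeal.absNorm := by
    have := P.1.isMaximal
    obtain ⟨p, k, hk, hmem, hp, h⟩ := P.1.asIdeal.exists_prime_and_absNorm_eq_pow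
    refine ⟨p, hp, by simpa using hmem, h ▸ Nat.pow_le_pow_right hp.pos ?_⟩
    by_contra! hk2
    obtain rfl : k = 1 := by lia
    exact P.2 (by simpa [h] using hp)
  choose p hp hmem hle using hex
  rw [← (Equiv.sigmaFiberEquiv p).tsum_eq, ENNReal.tsum_sigma']
  have hfiber (q : ℕ) : ∑' P : {P // p P = q},
      idealWeight (𝓞 K) 1 P.1.1.asIdeal ≤
        Module.finrank ℚ K * ((((q : NNReal) ^ 2)⁻¹ : NNReal) : ℝ≥0∞) := by
    rw [ENNReal.tsum_eq_iSup_sum]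
    refine iSup_le fun s ↦ ?_
    refine (Finset.sum_le_card_nsmul s _ ((((q : NNReal) ^ 2)⁻¹ : NNReal) : ℝ≥0∞) ?_).trans ?_
    · rintro ⟨P, rfl⟩ -
      have : (0 : NNReal) < p P := mod_cast (hp P).pos
      have : (p P : NNReal) ^ 2 ≤ P.1.asIdeal.absNorm := mod_cast hle P
      rw [idealWeight_one, ENNReal.coe_le_coe]
      gcongr
    · rw [nsmul_eq_mul]
      gcongr
      rcases s.eq_empty_or_nonempty with rfl | ⟨⟨P₀, rfl⟩, -⟩
      · simp
      · have := card_le_finrank_of_natCast_mem (K := K) (hp P₀)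
          (s.map ⟨fun P ↦ P.1.1, Subtype.val_injective.comp Subtype.val_injective⟩) ?_
        · rwa [Finset.card_map] at this
        · simp only [Finset.forall_mem_map]
          exact fun P _ ↦ by simpa [P.2] using hmem P.1
  refine ne_top_of_le_ne_top ?_ (ENNReal.tsum_le_tsum hfiber)
  rw [ENNReal.tsum_mul_left]
  refine ENNReal.mul_ne_top (by simp) (ENNReal.tsum_coe_ne_top_iff_summable.2 ?_)
  exact NNReal.summable_coe.1 (by simp)
theorem tsum_idealWeight_one_ne_top
    (hfin : {P : HeightOneSpectrum (𝓞 K) |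
      P.asIdeal.absNorm.Prime ∧ P.asIdeal.absNorm % 3 ≠ 1}.Finite) :
    ∑' P : {P : HeightOneSpectrum (𝓞 K) //
      ¬ (P.asIdeal.absNorm.Prime ∧ P.asIdeal.absNorm % 3 = 1)},
      idealWeight (𝓞 K) 1 P.1.asIdeal ≠ ∞ := by
  let f (P : HeightOneSpectrum (𝓞 K)) : ℝ≥0∞ := idealWeight (𝓞 K) 1 P.asIdeal
  let s := {P : HeightOneSpectrum (𝓞 K) | ¬ P.asIdeal.absNorm.Prime}
  let t := {P : HeightOneSpectrum (𝓞 K) | P.asIdeal.absNorm.Prime ∧ P.asIdeal.absNorm % 3 ≠ 1}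
  have hsub : {P : HeightOneSpectrum (𝓞 K) |
      ¬ (P.asIdeal.absNorm.Prime ∧ P.asIdeal.absNorm % 3 = 1)} ⊆ s ∪ t := by
    intro P hP
    simp only [s, t, Set.mem_union, Set.mem_ofPred_eq] at hP ⊢
    tauto
  have ht : ∑' P : t, f P ≠ ∞ := by
    have : Fintype t := hfin.fintype
    rw [tsum_fintype]
    exact ENNReal.sum_ne_top.2 fun P _ ↦ ENNReal.coe_ne_top
  exact ne_top_of_le_ne_top (ENNReal.add_ne_top.2 ⟨tsum_idealWeight_one_ne_top_of_not_prime, ht⟩)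
    ((ENNReal.tsum_mono_subtype f hsub).trans (ENNReal.tsum_union_le f s t))

theorem idealWeight_one_le (P : HeightOneSpectrum (𝓞 K)) :
    idealWeight (𝓞 K) 1 P.asIdeal ≤ 2⁻¹ := by
  have h1 : (2 : NNReal) ≤ P.asIdeal.absNorm := mod_cast HeightOneSpectrum.one_lt_absNorm P
  rw [idealWeight_one, ← ENNReal.coe_ofNat, ← ENNReal.coe_inv two_ne_zero, ENNReal.coe_le_coe]
  gcongr

end BadPrimes

section Main

variable {K L : Type*} [Field K] [NumberField K] [Field L] [NumberField L] [Algebra K L]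
  [IsCyclotomicExtension {3} K L]

theorem eulerSum_sq_le_tsum_idealWeight (h : Irreducible (cyclotomic 3 K)) {s : ℝ} (hs : 0 < s) :
    (eulerSum fun P : {P : HeightOneSpectrum (𝓞 K) //
      P.asIdeal.absNorm.Prime ∧ P.asIdeal.absNorm % 3 = 1} ↦ idealWeight (𝓞 K) s P.1.asIdeal) ^ 2 ≤
      ∑' I : Ideal (𝓞 L), idealWeight (𝓞 L) s I := by
  rw [tsum_idealWeight_eq_eulerSum hs.ne', sq, ← eulerSum_sumElim]
  choose Q Q' hne hQ hQ' using fun P : {P : HeightOneSpectrum (𝓞 K) //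
    P.asIdeal.absNorm.Prime ∧ P.asIdeal.absNorm % 3 = 1} ↦
    exists_pair_of_absNorm_mod_three (L := L) h P.1 P.2.1 P.2.2
  refine eulerSum_le_of_injective (Sum.elim Q Q') (Function.Injective.sumElim ?_ ?_ ?_) ?_
  · intro P P' hP
    exact Subtype.ext (HeightOneSpectrum.ext (by rw [← (hQ P).1, hP, (hQ P').1]))
  · intro P P' hP
    exact Subtype.ext (HeightOneSpectrum.ext (by rw [← (hQ' P).1, hP, (hQ' P').1]))
  · intro P P' hP
    obtain rfl : P = P' :=
      Subtype.ext (HeightOneSpectrum.ext (by rw [← (hQ P).1, hP, (hQ' P').1]))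
    exact hne P hP
  · rintro (P | P)
    · exact idealWeight_le_of_absNorm_le (absNorm_ne_zero _) (hQ P).2 hs.le
    · exact idealWeight_le_of_absNorm_le (absNorm_ne_zero _) (hQ' P).2 hs.le

variable (L) in
theorem exists_tsum_idealWeight_sq_le (h : Irreducible (cyclotomic 3 K))
    (hfin : {P : HeightOneSpectrum (𝓞 K) |
      P.asIdeal.absNorm.Prime ∧ P.asIdeal.absNorm % 3 ≠ 1}.Finite) :
    ∃ C : NNReal, ∀ s : ℝ, 1 ≤ s → (∑' I : Ideal (𝓞 K), idealWeight (𝓞 K) s I) ^ 2 ≤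
      C * ∑' I : Ideal (𝓞 L), idealWeight (𝓞 L) s I := by
  let bad (s : ℝ) := eulerSum fun P : {P : HeightOneSpectrum (𝓞 K) //
    ¬ (P.asIdeal.absNorm.Prime ∧ P.asIdeal.absNorm % 3 = 1)} ↦ idealWeight (𝓞 K) s P.1.asIdeal
  have hbad : bad 1 ≠ ∞ :=
    eulerSum_ne_top (fun P ↦ idealWeight_one_le P.1) (tsum_idealWeight_one_ne_top hfin)
  refine ⟨(bad 1).toNNReal ^ 2, fun s hs ↦ ?_⟩
  have hs0 : 0 < s := by linarith
  rw [ENNReal.coe_pow, ENNReal.coe_toNNReal hbad]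
  have hle : bad s ≤ bad 1 := eulerSum_mono fun P ↦ idealWeight_le_of_le (absNorm_ne_zero P.1) hs
  classical
  calc
    _ ≤ ((eulerSum fun P : {P : HeightOneSpectrum (𝓞 K) //
        P.asIdeal.absNorm.Prime ∧ P.asIdeal.absNorm % 3 = 1} ↦
        idealWeight (𝓞 K) s P.1.asIdeal) * bad s) ^ 2 := by
      rw [tsum_idealWeight_eq_eulerSum hs0.ne', ← eulerSum_sumElim]
      gcongr
      refine eulerSum_le_of_injective (Equiv.sumCompl _).symm (Equiv.injective _) fun P ↦ ?_
      obtain ⟨Q | Q, rfl⟩ := (Equiv.sumCompl fun P : HeightOneSpectrum (𝓞 K) ↦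
        P.asIdeal.absNorm.Prime ∧ P.asIdeal.absNorm % 3 = 1).surjective P <;> simp
    _ ≤ _ := by
      rw [mul_pow, mul_comm]
      gcongr
      exact eulerSum_sq_le_tsum_idealWeight h hs0

open Filter Topology in
theorem infinite_absNorm_mod_three_ne_one (h : Irreducible (cyclotomic 3 K)) :
    {P : HeightOneSpectrum (𝓞 K) |
      P.asIdeal.absNorm.Prime ∧ P.asIdeal.absNorm % 3 ≠ 1}.Infinite := by
  intro hfin
  let L := CyclotomicField 3 K
  obtain ⟨C, hC⟩ := exists_tsum_idealWeight_sq_le L h hfin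
  have htendsto (F : Type _) [Field F] [NumberField F] :
      Tendsto (fun s : ℝ ↦ (s - 1) * ‖dedekindZeta F s‖) (𝓝[>] 1) (𝓝 (dedekindZeta_residue F)) := by
    have := (tendsto_sub_one_mul_dedekindZeta_nhdsGT F).norm
    rw [Complex.norm_real, Real.norm_of_nonneg (dedekindZeta_residue_pos F).le] at this
    refine this.congr' ?_
    filter_upwards [self_mem_nhdsWithin] with s hs
    rw [norm_mul, ← Complex.ofReal_one, ← Complex.ofReal_sub, Complex.norm_real,
      Real.norm_of_nonneg (sub_nonneg.2 (Set.mem_Ioi.1 hs).le)]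
  have hne (F : Type _) [Field F] [NumberField F] :
      ∀ᶠ s : ℝ in 𝓝[>] 1, dedekindZeta F s ≠ 0 := by
    filter_upwards [(htendsto F).eventually_ne (dedekindZeta_residue_ne_zero F)] with s hs h0
    simp [h0] at hs
  have hle : ∀ᶠ s : ℝ in 𝓝[>] 1, ((s - 1) * ‖dedekindZeta K s‖) ^ 2 ≤
      C * (s - 1) * ((s - 1) * ‖dedekindZeta L s‖) := by
    filter_upwards [hne K, hne L, self_mem_nhdsWithin] with s hK hL hs
    have hs1 : 1 < s := hs
    have hs0 : s ≠ 0 := by linarith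
    have := hC s hs1.le
    rw [tsum_idealWeight_eq_ofReal_norm_dedekindZeta hs0 hK,
      tsum_idealWeight_eq_ofReal_norm_dedekindZeta hs0 hL, ← ENNReal.ofReal_coe_nnreal,
      ← ENNReal.ofReal_mul C.coe_nonneg, ← ENNReal.ofReal_pow (norm_nonneg _),
      ENNReal.ofReal_le_ofReal_iff (by positivity)] at this
    calc
      _ = (s - 1) ^ 2 * ‖dedekindZeta K s‖ ^ 2 := by ring
      _ ≤ (s - 1) ^ 2 * (C * ‖dedekindZeta L s‖) := by gcongr
      _ = _ := by ring
  have hlim : Tendsto (fun s : ℝ ↦ C * (s - 1) * ((s - 1) * ‖dedekindZeta L s‖))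
      (𝓝[>] 1) (𝓝 0) := by
    have h0 : Tendsto (fun s : ℝ ↦ C * (s - 1)) (𝓝[>] 1) (𝓝 0) :=
      (Continuous.tendsto' (by fun_prop) _ _ (by simp)).mono_left nhdsWithin_le_nhds
    simpa using h0.mul (htendsto L)
  have hpos := dedekindZeta_residue_pos K
  have := le_of_tendsto_of_tendsto ((htendsto K).pow 2) hlim hle
  nlinarith

end Main

theorem infinitely_many_degree_one_primes_two_mod_three
    (f : Polynomial ℤ) (hf : Irreducible f) (hdeg : 0 < f.natDegree)
    (K : Type) [Field K] [NumberField K] (x : K)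
    (hx : Polynomial.aeval x f = 0)
    (hgen : Algebra.adjoin ℚ {x} = ⊤)
    (hmu3 : ∀ z : K, z ^ 2 + z + 1 ≠ 0) :
    {p : ℕ | p.Prime ∧ p % 3 = 2 ∧
      ∃ P : Ideal (RingOfIntegers K), P.IsPrime ∧ P ≠ ⊥ ∧
        (p : RingOfIntegers K) ∈ P ∧ Nat.card (RingOfIntegers K ⧸ P) = p}.Infinite := by
  intro hfin
  refine infinite_absNorm_mod_three_ne_one (cyclotomic_three_irreducible_of_forall_ne hmu3) ?_
  have hfin' := (hfin.insert 3).biUnion fun n _ ↦ Ideal.finite_setOfPred_absNorm_eq (S := 𝓞 K) n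
  refine (hfin'.preimage fun P _ Q _ h ↦ HeightOneSpectrum.ext h).subset fun P hP ↦ ?_
  refine Set.mem_biUnion (x := P.asIdeal.absNorm) ?_ rfl
  obtain ⟨hprime, hmod⟩ := hP
  by_cases h3 : P.asIdeal.absNorm = 3
  · exact Or.inl h3
  have hdvd : ¬ 3 ∣ P.asIdeal.absNorm := fun h ↦
    h3 ((Nat.prime_dvd_prime_iff_eq Nat.prime_three hprime).1 h).symm
  refine Or.inr ⟨hprime, by lia, P.asIdeal, P.isPrime, P.ne_bot, Ideal.absNorm_mem _, ?_⟩
  rw [Ideal.absNorm_apply, Submodule.cardQuot_apply]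
end

section
/- Let g(t) ∈ ℤ[t] be an irreducible nonconstant polynomial and let N = ℚ[t]/(g(t)), a number field. Suppose that N contains no primitive fourth root of unity, i.e., no element x ∈ N satisfies x² = −1. Then there are infinitely many rational primes p such that p ≡ 3 (mod 4) and such that there exists a prime ideal 𝔭 of the ring of integers of N lying over p with residue degree 1, i.e., [O_N/𝔭 : 𝔽_p] = 1. -/
open Polynomial NumberField
open Filter Topology
open scoped ENNReal

universe u

theorem ENNReal.prod_tsum_eq_tsum_pi {ι : Type*} [Fintype ι] {κ : Type*} (f : ι → κ → ℝ≥0∞) :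
    ∏ i, ∑' e, f i e = ∑' v : ι → κ, ∏ i, f i (v i) := by
  classical
  revert f
  refine Fintype.induction_empty_option
    (P := fun ι _ ↦ ∀ f : ι → κ → ℝ≥0∞, ∏ i, ∑' e, f i e = ∑' v : ι → κ, ∏ i, f i (v i))
    ?_ ?_ ?_ ι
  · intro α β _ e h f
    let := Fintype.ofEquiv β e.symm
    rw [← e.prod_comp, ← (e.arrowCongr (Equiv.refl κ)).tsum_eq]
    convert h (fun a ↦ f (e a)) using 1
    refine tsum_congr fun v ↦ ?_
    rw [← e.prod_comp]
    simp
  · intro f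
    simp
  · intro α _ h f
    rw [Fintype.prod_option, h,
      ← (Equiv.piOptionEquivProd (β := fun _ : Option α ↦ κ)).symm.tsum_eq,
      ENNReal.tsum_prod', ← ENNReal.tsum_mul_right]
    refine tsum_congr fun a ↦ ?_
    rw [← ENNReal.tsum_mul_left]
    refine tsum_congr fun v ↦ ?_
    simp [Fintype.prod_option, Equiv.piOptionEquivProd]

namespace Ideal

variable {R : Type*} [CommRing R] [IsDedekindDomain R] (f : Ideal R →*₀ ℝ≥0∞)

omit [IsDedekindDomain R] in
theorem prod_one_sub_inv_eq_tsum (S : Finset (Ideal R)) :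
    ∏ P ∈ S, (1 - f P)⁻¹ = ∑' v : S → ℕ, f (∏ P : S, (P : Ideal R) ^ v P) := by
  simp_rw [← ENNReal.tsum_geometric, ← Finset.prod_coe_sort S, ENNReal.prod_tsum_eq_tsum_pi,
    map_prod, map_pow]

theorem prod_one_sub_inv_le_tsum (S : Finset (Ideal R)) (hS : ∀ P ∈ S, Prime P) :
    ∏ P ∈ S, (1 - f P)⁻¹ ≤ ∑' I, f I := by
  classical
  rw [prod_one_sub_inv_eq_tsum]
  refine ENNReal.tsum_comp_le_tsum_of_injective (f := fun v : S → ℕ ↦ ∏ P : S, (P : Ideal R) ^ v P)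
    (fun v w h ↦ ?_) f
  have key (v : S → ℕ) (P : S) :
      (UniqueFactorizationMonoid.normalizedFactors (∏ P : S, (P : Ideal R) ^ v P)).count
        (P : Ideal R) = v P := by
    have h : ∏ P : S, (P : Ideal R) ^ v P =
        (∑ P : S, Multiset.replicate (v P) (P : Ideal R)).prod := by
      simp [Multiset.prod_sum]
    rw [h, UniqueFactorizationMonoid.normalizedFactors_prod_eq, Multiset.map_congr rfl
      fun I _ ↦ normalize_eq I, Multiset.map_id', Multiset.count_sum']
    · simp [Multiset.count_replicate]
    · intro I hI
      obtain ⟨Q, -, hQ⟩ := Multiset.mem_sum.mp hI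
      rw [Multiset.eq_of_mem_replicate hQ]
      exact (hS Q Q.2).irreducible
  funext P
  rw [← key v, ← key w]
  exact congrArg (fun I ↦ (UniqueFactorizationMonoid.normalizedFactors I).count (P : Ideal R)) h

theorem tsum_le_of_prod_one_sub_inv_le {B : ℝ≥0∞}
    (hB : ∀ S : Finset (Ideal R), (∀ P ∈ S, Prime P) → ∏ P ∈ S, (1 - f P)⁻¹ ≤ B) :
    ∑' I, f I ≤ B := by
  classical
  rw [ENNReal.tsum_eq_iSup_sum]
  refine iSup_le fun A ↦ ?_
  let S : Finset (Ideal R) :=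
    A.biUnion fun I ↦ (UniqueFactorizationMonoid.normalizedFactors I).toFinset
  have hS : ∀ P ∈ S, Prime P := by
    intro P hP
    obtain ⟨I, -, hI⟩ := Finset.mem_biUnion.mp hP
    exact UniqueFactorizationMonoid.prime_of_normalized_factor P (Multiset.mem_toFinset.mp hI)
  refine le_trans ?_ (hB S hS)
  rw [prod_one_sub_inv_eq_tsum, ← Finset.sum_filter_ne_zero]
  let v : Ideal R → S → ℕ := fun I P ↦ (UniqueFactorizationMonoid.normalizedFactors I).count ↑P
  have hv : ∀ I ∈ A.filter (f · ≠ 0), ∏ P : S, (P : Ideal R) ^ v I P = I := by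
    intro I hI
    obtain ⟨hIA, hI0⟩ := Finset.mem_filter.mp hI
    have hI : I ≠ ⊥ := by
      rintro rfl
      exact hI0 (map_zero f)
    rw [Finset.prod_coe_sort S
      (fun P ↦ P ^ (UniqueFactorizationMonoid.normalizedFactors I).count P),
      ← Finset.prod_multiset_count_of_subset]
    · exact prod_normalizedFactors_eq_self hI
    · exact Finset.subset_biUnion_of_mem
        (fun I ↦ (UniqueFactorizationMonoid.normalizedFactors I).toFinset) hIA
  calc ∑ I ∈ A.filter (f · ≠ 0), f I
      = ∑ I ∈ A.filter (f · ≠ 0), f (∏ P : S, (P : Ideal R) ^ v I P) :=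
        Finset.sum_congr rfl fun I hI ↦ by rw [hv I hI]
    _ = ∑ w ∈ (A.filter (f · ≠ 0)).image v, f (∏ P : S, (P : Ideal R) ^ w P) := by
        rw [Finset.sum_image]
        intro I hI J hJ h
        rw [← hv I hI, ← hv J hJ, h]
    _ ≤ _ := ENNReal.sum_le_tsum _

end Ideal

namespace NumberField

noncomputable def idealNormRpow (K : Type*) [Field K] [NumberField K] {s : ℝ} (hs : 0 < s) :
    Ideal (𝓞 K) →*₀ ℝ≥0∞ where
  toFun I := ENNReal.ofReal ((Ideal.absNorm I : ℝ) ^ (-s))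
  map_zero' := by simp [hs.ne']
  map_one' := by simp
  map_mul' I J := by
    rw [map_mul, Nat.cast_mul, Real.mul_rpow (Nat.cast_nonneg _) (Nat.cast_nonneg _),
      ENNReal.ofReal_mul (by positivity)]

theorem tendsto_sub_one_mul_tsum_absNorm_rpow (K : Type*) [Field K] [NumberField K] :
    Tendsto (fun s : ℝ ↦ ENNReal.ofReal (s - 1) *
        ∑' I : Ideal (𝓞 K), ENNReal.ofReal ((Ideal.absNorm I : ℝ) ^ (-s)))
      (𝓝[>] 1) (𝓝 (ENNReal.ofReal (dedekindZeta_residue K))) := by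
  have hζ := tendsto_sub_one_mul_dedekindZeta_nhdsGT K
  have hre := (Complex.continuous_re.tendsto _).comp hζ
  refine ((ENNReal.continuous_ofReal.tendsto _).comp hre).congr' ?_
  filter_upwards [hζ.eventually_ne (Complex.ofReal_ne_zero.mpr (dedekindZeta_residue_ne_zero K)),
    self_mem_nhdsWithin] with s hs hs1
  have hs1 : 1 < s := hs1
  let t : ℕ → ℝ := fun n ↦ Nat.card {I : Ideal (𝓞 K) // Ideal.absNorm I = n} * (n : ℝ) ^ (-s)
  have ht0 (n : ℕ) : 0 ≤ t n := by positivity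
  have hζt : dedekindZeta K s = ((∑' n, t n : ℝ) : ℂ) := by
    rw [dedekindZeta, LSeries, Complex.ofReal_tsum]
    refine tsum_congr fun n ↦ ?_
    rw [LSeries.term_of_ne_zero' (by simp; linarith), div_eq_mul_inv, ← Complex.cpow_neg]
    simp only [t]
    push_cast
    rw [Complex.ofReal_cpow (Nat.cast_nonneg n)]
    simp
  have hsum : Summable t := by
    by_contra h
    simp [hζt, tsum_eq_zero_of_not_summable h] at hs
  have hfib : ∑' I : Ideal (𝓞 K), ENNReal.ofReal ((Ideal.absNorm I : ℝ) ^ (-s)) =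
      ENNReal.ofReal (∑' n, t n) := by
    rw [ENNReal.ofReal_tsum_of_nonneg ht0 hsum,
      ← (Equiv.sigmaFiberEquiv fun I : Ideal (𝓞 K) ↦ Ideal.absNorm I).tsum_eq,
      ENNReal.tsum_sigma']
    refine tsum_congr fun n ↦ ?_
    have : Finite {I : Ideal (𝓞 K) // Ideal.absNorm I = n} := Ideal.finite_setOfPred_absNorm_eq n
    rw [tsum_congr fun I : {I : Ideal (𝓞 K) // Ideal.absNorm I = n} ↦
      show _ = ENNReal.ofReal ((n : ℝ) ^ (-s)) by simp [Equiv.sigmaFiberEquiv, I.2]]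
    rw [ENNReal.tsum_const, ENat.card_eq_coe_natCard, ENNReal.ofReal_mul (Nat.cast_nonneg _)]
    simp
  simp only [Function.comp_apply]
  rw [hfib, hζt, ← ENNReal.ofReal_mul (by linarith)]
  norm_cast

end NumberField

namespace NumberField

theorem exists_pair_primes_over {K L : Type*} [Field K] [NumberField K] [Field L] [NumberField L]
    [Algebra K L] (h2 : Module.finrank K L = 2) {j : L} (hj : j ^ 2 = -1) (σ : L →ₐ[K] L)
    (hσ : σ j = -j) {P : Ideal (𝓞 K)} [P.IsPrime] {p : ℕ} (hp : p.Prime) (hp2 : p ≠ 2)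
    (hp4 : p % 4 ≠ 3) (hpP : Ideal.absNorm P = p) :
    ∃ Q₁ Q₂ : Ideal (𝓞 L), Q₁ ≠ Q₂ ∧
      (Prime Q₁ ∧ Q₁.under (𝓞 K) = P ∧ Ideal.absNorm Q₁ = p) ∧
      (Prime Q₂ ∧ Q₂.under (𝓞 K) = P ∧ Ideal.absNorm Q₂ = p) := by
  classical
  have := Fact.mk hp
  have hP0 : P ≠ ⊥ := by
    rintro rfl
    simp [hp.ne_zero.symm] at hpP
  have hPmax : P.IsMaximal := ‹P.IsPrime›.isMaximal hP0
  have hpmem : (p : 𝓞 K) ∈ P := hpP ▸ Ideal.absNorm_mem P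
  obtain ⟨a, k, hak⟩ : ∃ a k : ℤ, a ^ 2 + 1 = p * k := by
    obtain ⟨y, hy⟩ := ZMod.exists_sq_eq_neg_one_iff.mpr hp4
    obtain ⟨a, rfl⟩ := ZMod.intCast_surjective y
    have : ((a ^ 2 + 1 : ℤ) : ZMod p) = 0 := by
      push_cast
      rw [pow_two, ← hy]
      ring
    exact ⟨a, (ZMod.intCast_zmod_eq_zero_iff_dvd _ p).mp this⟩
  have hjint : IsIntegral ℤ j :=
    IsIntegral.of_pow (n := 2) two_pos (hj ▸ isIntegral_one.neg)
  obtain ⟨J, rfl⟩ : ∃ J : 𝓞 L, (J : L) = j := ⟨⟨j, hjint⟩, rfl⟩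
  have hJ : J ^ 2 = -1 := by
    ext
    simpa using hj
  let τ : 𝓞 L →ₐ[𝓞 K] 𝓞 L := RingOfIntegers.mapAlgHom σ
  have hτ : τ J = -J := by
    refine RingOfIntegers.ext ?_
    exact hσ.trans (map_neg (algebraMap (𝓞 L) L) J).symm
  obtain ⟨Q, hQmax, hQP⟩ := Ideal.exists_maximal_ideal_liesOver_of_isIntegral (S := 𝓞 L) P
  let Q' := Q.comap τ
  have hQ'prime : Q'.IsPrime := Ideal.comap_isPrime τ Q
  have hQ'P : Q'.LiesOver P := by
    constructor
    rw [hQP.over]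
    ext x
    simp [Q', Ideal.under_def, Ideal.mem_comap]
  have hpQ : (p : 𝓞 L) ∈ Q := by
    have := hpmem
    rw [hQP.over, Ideal.under_def, Ideal.mem_comap] at this
    simpa using this
  have hmul : (J - a) * (J + a) ∈ Q := by
    have h : (J - a) * (J + a) = -(p * (k : 𝓞 L)) := by
      have : ((a ^ 2 + 1 : ℤ) : 𝓞 L) = ((p * k : ℤ) : 𝓞 L) := by rw [hak]
      push_cast at this
      linear_combination hJ - this
    rw [h]
    exact Q.neg_mem (Q.mul_mem_right _ hpQ)
  have hne : Q ≠ Q' := by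
    intro hQQ
    have h2J : 2 * J ∈ Q := by
      rcases hQmax.isPrime.mem_or_mem hmul with h | h
      · have h' : τ (J - a) ∈ Q := by
          have := h
          rw [hQQ] at this
          exact this
        have := Q.sub_mem h h'
        simp only [map_sub, hτ, map_intCast] at this
        ring_nf at this ⊢
        exact this
      · have h' : τ (J + a) ∈ Q := by
          have := h
          rw [hQQ] at this
          exact this
        have := Q.sub_mem h h'
        simp only [map_add, hτ, map_intCast] at this
        ring_nf at this ⊢
        exact this
    have h2 : (2 : 𝓞 L) ∈ Q := by
      have := Q.mul_mem_left (-J) h2J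
      rwa [show -J * (2 * J) = 2 by linear_combination -2 * hJ] at this
    obtain ⟨m, hm⟩ := hp.odd_of_ne_two hp2
    refine hQmax.ne_top ((Ideal.eq_top_iff_one Q).mpr ?_)
    have := Q.sub_mem hpQ (Q.mul_mem_right (m : 𝓞 L) h2)
    rw [hm] at this
    simpa using this
  have hsum := Ideal.sum_ramification_inertia_eq_finrank P (𝓞 L)
  have hfin : Module.finrank (𝓞 K) (𝓞 L) = 2 := by
    rw [← h2]
    exact (IsFractionRing.finrank_eq (𝓞 K) K (𝓞 L) L).symm
  let q : P.primesOver (𝓞 L) := ⟨Q, hQmax.isPrime, hQP⟩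
  let q' : P.primesOver (𝓞 L) := ⟨Q', hQ'prime, hQ'P⟩
  have hqq' : q ≠ q' := fun h ↦ hne (congrArg Subtype.val h)
  have hle : ∑ r ∈ {q, q'}, r.1.ramificationIdx (𝓞 K) * r.1.inertiaDeg (𝓞 K) ≤ 2 := by
    rw [← hfin, ← hsum]
    exact Finset.sum_le_univ_sum_of_nonneg fun _ ↦ Nat.zero_le _
  rw [Finset.sum_pair hqq'] at hle
  have he := Q.ramificationIdx_pos (𝓞 K)
  have he' := Q'.ramificationIdx_pos (𝓞 K)
  have hf := Q.inertiaDeg_pos (𝓞 K)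
  have hf' := Q'.inertiaDeg_pos (𝓞 K)
  have hQ1 : Q.inertiaDeg (𝓞 K) = 1 := by nlinarith
  have hQ'1 : Q'.inertiaDeg (𝓞 K) = 1 := by nlinarith
  have hN := Ideal.absNorm_pow_inertiaDeg P Q
  have hN' := Ideal.absNorm_pow_inertiaDeg P Q'
  rw [hQ1, pow_one, hpP] at hN
  rw [hQ'1, pow_one, hpP] at hN'
  have hQ0 : Q ≠ ⊥ := Ideal.ne_bot_of_liesOver_of_ne_bot hP0 Q
  have hQ'0 : Q' ≠ ⊥ := Ideal.ne_bot_of_liesOver_of_ne_bot hP0 Q'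
  exact ⟨Q, Q', hne, ⟨Ideal.prime_of_isPrime hQ0 hQmax.isPrime, hQP.over.symm, hN.symm⟩,
    ⟨Ideal.prime_of_isPrime hQ'0 hQ'prime, hQ'P.over.symm, hN'.symm⟩⟩

end NumberField

theorem Ideal.ncard_primesOver_le_finrank {R : Type*} (S : Type*) [CommRing R] [IsDomain R]
    [CommRing S] [Algebra R S] [Module.Finite R S] [Module.Flat R S] (p : Ideal R) [p.IsPrime] :
    (p.primesOver S).ncard ≤ Module.finrank R S := by
  have : Fintype (p.primesOver S) := (Algebra.QuasiFinite.finite_primesOver p).fintype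
  rw [← Ideal.sum_ramification_inertia_eq_finrank p S, ← Set.fintypeCard_eq_ncard,
    Fintype.card_eq_sum_ones]
  refine Finset.sum_le_sum fun q _ ↦ ?_
  have := q.2.1
  exact Nat.mul_pos (q.1.ramificationIdx_pos R) (q.1.inertiaDeg_pos R)

namespace NumberField

theorem exists_sum_inv_absNorm_le_of_not_prime (K : Type*) [Field K] [NumberField K] :
    ∃ C : ℝ, ∀ S : Finset (Ideal (𝓞 K)), (∀ P ∈ S, Prime P ∧ ¬ (Ideal.absNorm P).Prime) →
      ∑ P ∈ S, (Ideal.absNorm P : ℝ)⁻¹ ≤ C := by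
  classical
  have hsum : Summable fun n : ℕ ↦ ((n : ℝ) ^ 2)⁻¹ := Real.summable_nat_pow_inv.mpr one_lt_two
  refine ⟨Module.finrank ℤ (𝓞 K) * ∑' n : ℕ, ((n : ℝ) ^ 2)⁻¹, fun S hS ↦ ?_⟩
  let ℓ : Ideal (𝓞 K) → ℕ := fun P ↦ Ideal.absNorm (P.under ℤ)
  have hℓ : ∀ P ∈ S, (ℓ P).Prime := fun P hP ↦ by
    have := Ideal.isPrime_of_prime (hS P hP).1
    have : NeZero P := ⟨(hS P hP).1.ne_zero⟩
    exact Nat.absNorm_under_prime P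
  have hterm : ∀ P ∈ S, (Ideal.absNorm P : ℝ)⁻¹ ≤ ((ℓ P : ℝ) ^ 2)⁻¹ := fun P hP ↦ by
    have := Ideal.isPrime_of_prime (hS P hP).1
    have hN : ℓ P ^ P.inertiaDeg ℤ = Ideal.absNorm P :=
      Ideal.absNorm_pow_inertiaDeg (P.under ℤ) P
    have hf := P.inertiaDeg_pos ℤ
    have hf1 : P.inertiaDeg ℤ ≠ 1 := fun h ↦ by
      rw [h, pow_one] at hN
      exact (hS P hP).2 (hN ▸ hℓ P hP)
    have hp := (hℓ P hP).pos
    rw [← hN]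
    push_cast
    gcongr
    · exact_mod_cast hp
    · lia
  have hcard (n : ℕ) (hn : n ∈ S.image ℓ) :
      (S.filter (ℓ · = n)).card ≤ Module.finrank ℤ (𝓞 K) := by
    obtain ⟨P₀, hP₀, rfl⟩ := Finset.mem_image.mp hn
    have := Ideal.isPrime_of_prime (hS P₀ hP₀).1
    refine le_trans ?_ (Ideal.ncard_primesOver_le_finrank (𝓞 K) (P₀.under ℤ))
    rw [← Set.ncard_coe_finset]
    refine Set.ncard_le_ncard (fun P hP ↦ ?_) (Algebra.QuasiFinite.finite_primesOver _)
    obtain ⟨hPS, hPℓ⟩ := Finset.mem_filter.mp hP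
    refine ⟨Ideal.isPrime_of_prime (hS P hPS).1, ⟨?_⟩⟩
    rw [← Int.ideal_span_absNorm_eq_self (P.under ℤ),
      ← Int.ideal_span_absNorm_eq_self (P₀.under ℤ)]
    exact congrArg (fun n : ℕ ↦ Ideal.span {(n : ℤ)}) hPℓ.symm
  calc ∑ P ∈ S, (Ideal.absNorm P : ℝ)⁻¹
      ≤ ∑ P ∈ S, ((ℓ P : ℝ) ^ 2)⁻¹ := Finset.sum_le_sum hterm
    _ = ∑ n ∈ S.image ℓ, (S.filter (ℓ · = n)).card • ((n : ℝ) ^ 2)⁻¹ :=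
        Finset.sum_comp (fun n : ℕ ↦ ((n : ℝ) ^ 2)⁻¹) ℓ
    _ ≤ ∑ n ∈ S.image ℓ, Module.finrank ℤ (𝓞 K) * ((n : ℝ) ^ 2)⁻¹ := by
        refine Finset.sum_le_sum fun n hn ↦ ?_
        rw [nsmul_eq_mul]
        gcongr
        exact hcard n hn
    _ ≤ _ := by
        rw [← Finset.mul_sum]
        gcongr
        exact hsum.sum_le_tsum _ fun _ _ ↦ by positivity

end NumberField

theorem ENNReal.one_sub_ofReal_inv_le_ofReal_exp {y z : ℝ} (hyz : y ≤ z) (hz : z ≤ 1 / 2)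
    (hy : 0 ≤ y) : (1 - ENNReal.ofReal y)⁻¹ ≤ ENNReal.ofReal (Real.exp (2 * z)) := by
  rw [← ENNReal.ofReal_one, ← ENNReal.ofReal_sub _ hy,
    ← ENNReal.ofReal_inv_of_pos (by linarith)]
  refine ENNReal.ofReal_le_ofReal ?_
  calc (1 - y)⁻¹ ≤ (1 - z)⁻¹ := by
        gcongr
        linarith
    _ ≤ 2 * z + 1 := by
        rw [inv_le_iff_one_le_mul₀ (by linarith)]
        nlinarith
    _ ≤ _ := Real.add_one_le_exp _

namespace NumberField

theorem exists_tsum_sq_le {K L : Type*} [Field K] [NumberField K] [Field L] [NumberField L]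
    [Algebra K L] (h2 : Module.finrank K L = 2) {j : L} (hj : j ^ 2 = -1) (σ : L →ₐ[K] L)
    (hσ : σ j = -j)
    (hfin : {P : Ideal (𝓞 K) | (Ideal.absNorm P).Prime ∧ Ideal.absNorm P % 4 = 3}.Finite) :
    ∃ C : ℝ≥0∞, C ≠ ∞ ∧ ∀ s : ℝ, 1 < s →
      (∑' I : Ideal (𝓞 K), ENNReal.ofReal ((Ideal.absNorm I : ℝ) ^ (-s))) ^ 2 ≤
        C * ∑' I : Ideal (𝓞 L), ENNReal.ofReal ((Ideal.absNorm I : ℝ) ^ (-s)) := by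
  classical
  let good : Ideal (𝓞 K) → Prop := fun P ↦
    (Ideal.absNorm P).Prime ∧ Ideal.absNorm P ≠ 2 ∧ Ideal.absNorm P % 4 ≠ 3
  obtain ⟨C₁, hC₁⟩ := exists_sum_inv_absNorm_le_of_not_prime K
  have hF := hfin.union (Ideal.finite_setOfPred_absNorm_eq (S := 𝓞 K) 2)
  let C₂ : ℝ := ∑ P ∈ hF.toFinset, (Ideal.absNorm P : ℝ)⁻¹
  have hbad : ∀ S : Finset (Ideal (𝓞 K)), (∀ P ∈ S, Prime P ∧ ¬ good P) →
      ∑ P ∈ S, (Ideal.absNorm P : ℝ)⁻¹ ≤ C₂ + C₁ := fun S hS ↦ by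
    rw [← Finset.sum_filter_add_sum_filter_not S (fun P ↦ (Ideal.absNorm P).Prime)]
    refine add_le_add (Finset.sum_le_sum_of_subset_of_nonneg (fun P hP ↦ ?_)
      fun _ _ _ ↦ by positivity) (hC₁ _ fun P hP ↦ ?_)
    · obtain ⟨hPS, hPp⟩ := Finset.mem_filter.mp hP
      have := (hS P hPS).2
      simp only [good] at this
      simp only [Set.Finite.mem_toFinset, Set.mem_union, Set.mem_ofPred_eq]
      tauto
    · obtain ⟨hPS, hPp⟩ := Finset.mem_filter.mp hP
      exact ⟨(hS P hPS).1, hPp⟩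
  have hsplit : ∀ P : Ideal (𝓞 K), Prime P → good P → ∃ Q₁ Q₂ : Ideal (𝓞 L), Q₁ ≠ Q₂ ∧
      (Prime Q₁ ∧ Q₁.under (𝓞 K) = P ∧ Ideal.absNorm Q₁ = Ideal.absNorm P) ∧
      (Prime Q₂ ∧ Q₂.under (𝓞 K) = P ∧ Ideal.absNorm Q₂ = Ideal.absNorm P) :=
    fun P hP hg ↦ by
      have := Ideal.isPrime_of_prime hP
      exact exists_pair_primes_over h2 hj σ hσ hg.1 hg.2.1 hg.2.2 rfl
  choose! Q₁ Q₂ hne hQ₁ hQ₂ using hsplit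
  let D : ℝ≥0∞ := ENNReal.ofReal (Real.exp (2 * (C₂ + C₁)))
  refine ⟨D ^ 2, by finiteness, fun s hs ↦ ?_⟩
  have hs0 : 0 < s := by linarith
  let f := idealNormRpow K hs0
  let g := idealNormRpow L hs0
  have hfg (P : Ideal (𝓞 K)) (Q : Ideal (𝓞 L)) (h : Ideal.absNorm Q = Ideal.absNorm P) :
      g Q = f P := by
    change ENNReal.ofReal _ = ENNReal.ofReal _
    rw [h]
  change (∑' I, f I) ^ 2 ≤ D ^ 2 * ∑' I, g I
  have hgood (S : Finset (Ideal (𝓞 K))) (hS : ∀ P ∈ S, Prime P ∧ good P) :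
      (∏ P ∈ S, (1 - f P)⁻¹) ^ 2 ≤ ∑' I, g I := by
    have hinj₁ : Set.InjOn Q₁ S := fun P hP P' hP' h ↦ by
      rw [← (hQ₁ P (hS P hP).1 (hS P hP).2).2.1, h, (hQ₁ P' (hS P' hP').1 (hS P' hP').2).2.1]
    have hinj₂ : Set.InjOn Q₂ S := fun P hP P' hP' h ↦ by
      rw [← (hQ₂ P (hS P hP).1 (hS P hP).2).2.1, h, (hQ₂ P' (hS P' hP').1 (hS P' hP').2).2.1]
    have hdisj : Disjoint (S.image Q₁) (S.image Q₂) := by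
      rw [Finset.disjoint_left]
      intro Q h h'
      obtain ⟨P, hP, rfl⟩ := Finset.mem_image.mp h
      obtain ⟨P', hP', h''⟩ := Finset.mem_image.mp h'
      have : P' = P := by
        rw [← (hQ₁ P (hS P hP).1 (hS P hP).2).2.1, ← h'',
          (hQ₂ P' (hS P' hP').1 (hS P' hP').2).2.1]
      exact hne P (hS P hP).1 (hS P hP).2 (this ▸ h''.symm)
    have hT := Ideal.prod_one_sub_inv_le_tsum g (S.image Q₁ ∪ S.image Q₂) fun Q hQ ↦ by
      rcases Finset.mem_union.mp hQ with h | h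
      · obtain ⟨P, hP, rfl⟩ := Finset.mem_image.mp h
        exact (hQ₁ P (hS P hP).1 (hS P hP).2).1
      · obtain ⟨P, hP, rfl⟩ := Finset.mem_image.mp h
        exact (hQ₂ P (hS P hP).1 (hS P hP).2).1
    rw [Finset.prod_union hdisj, Finset.prod_image hinj₁, Finset.prod_image hinj₂] at hT
    rw [pow_two]
    convert hT using 2
    · exact Finset.prod_congr rfl fun P hP ↦ by
        rw [hfg P _ (hQ₁ P (hS P hP).1 (hS P hP).2).2.2]
    · exact Finset.prod_congr rfl fun P hP ↦ by
        rw [hfg P _ (hQ₂ P (hS P hP).1 (hS P hP).2).2.2]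
  have hbadprod (S : Finset (Ideal (𝓞 K))) (hS : ∀ P ∈ S, Prime P ∧ ¬ good P) :
      ∏ P ∈ S, (1 - f P)⁻¹ ≤ D := by
    calc ∏ P ∈ S, (1 - f P)⁻¹
        ≤ ∏ P ∈ S, ENNReal.ofReal (Real.exp (2 * (Ideal.absNorm P : ℝ)⁻¹)) := by
          refine Finset.prod_le_prod' fun P hP ↦ ?_
          have hN0 : Ideal.absNorm P ≠ 0 := fun h ↦
            (hS P hP).1.ne_zero (Ideal.absNorm_eq_zero_iff.mp h)
          have hN1 : Ideal.absNorm P ≠ 1 := fun h ↦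
            (Ideal.isPrime_of_prime (hS P hP).1).ne_top (Ideal.absNorm_eq_one_iff.mp h)
          have hN : (2 : ℝ) ≤ Ideal.absNorm P := by exact_mod_cast (by lia : 2 ≤ Ideal.absNorm P)
          refine ENNReal.one_sub_ofReal_inv_le_ofReal_exp ?_ ?_ (by positivity)
          · rw [← Real.rpow_neg_one]
            exact Real.rpow_le_rpow_of_exponent_le (by linarith) (by linarith)
          · rw [one_div]
            gcongr
      _ = ENNReal.ofReal (Real.exp (2 * ∑ P ∈ S, (Ideal.absNorm P : ℝ)⁻¹)) := by
          rw [← ENNReal.ofReal_prod_of_nonneg fun _ _ ↦ (Real.exp_pos _).le, ← Real.exp_sum,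
            Finset.mul_sum]
      _ ≤ D := by
          refine ENNReal.ofReal_le_ofReal (Real.exp_le_exp.mpr ?_)
          linarith [hbad S hS]
  have hK : ∑' I, f I ≤ (∑' I, g I) ^ (2⁻¹ : ℝ) * D := by
    refine Ideal.tsum_le_of_prod_one_sub_inv_le f fun S hS ↦ ?_
    rw [← Finset.prod_filter_mul_prod_filter_not S good]
    refine mul_le_mul' ?_ (hbadprod _ fun P hP ↦ ?_)
    · rw [ENNReal.le_rpow_inv_iff (by norm_num)]
      have := hgood (S.filter good) fun P hP ↦
        ⟨hS P (Finset.mem_filter.mp hP).1, (Finset.mem_filter.mp hP).2⟩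
      simpa using this
    · exact ⟨hS P (Finset.mem_filter.mp hP).1, (Finset.mem_filter.mp hP).2⟩
  calc (∑' I, f I) ^ 2 ≤ ((∑' I, g I) ^ (2⁻¹ : ℝ) * D) ^ 2 := by gcongr
    _ = D ^ 2 * ∑' I, g I := by
        rw [mul_pow, mul_comm, ← ENNReal.rpow_mul_natCast]
        norm_num

theorem infinite_setOf_absNorm_prime_mod_four_eq_three {K L : Type*} [Field K] [NumberField K]
    [Field L] [NumberField L] [Algebra K L] (h2 : Module.finrank K L = 2) {j : L}
    (hj : j ^ 2 = -1) (σ : L →ₐ[K] L) (hσ : σ j = -j) :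
    {P : Ideal (𝓞 K) | (Ideal.absNorm P).Prime ∧ Ideal.absNorm P % 4 = 3}.Infinite := by
  intro hfin
  obtain ⟨C, hC, hle⟩ := exists_tsum_sq_le h2 hj σ hσ hfin
  have hK := ENNReal.Tendsto.pow (n := 2) (tendsto_sub_one_mul_tsum_absNorm_rpow K)
  have hL := tendsto_sub_one_mul_tsum_absNorm_rpow L
  have hs : Tendsto (fun s : ℝ ↦ C * ENNReal.ofReal (s - 1)) (𝓝[>] 1) (𝓝 0) := by
    have : Tendsto (fun s : ℝ ↦ ENNReal.ofReal (s - 1)) (𝓝[>] 1) (𝓝 0) := by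
      have h : Continuous fun s : ℝ ↦ ENNReal.ofReal (s - 1) :=
        ENNReal.continuous_ofReal.comp (continuous_id.sub continuous_const)
      simpa using (h.tendsto 1).mono_left nhdsWithin_le_nhds
    simpa using ENNReal.Tendsto.const_mul this (Or.inr hC)
  have hR := ENNReal.Tendsto.mul hs (Or.inr ENNReal.ofReal_ne_top) hL (Or.inr ENNReal.zero_ne_top)
  have hlim := le_of_tendsto_of_tendsto hK hR (by
    filter_upwards [self_mem_nhdsWithin] with s hs
    rw [mul_pow]
    calc _ ≤ ENNReal.ofReal (s - 1) ^ 2 *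
          (C * ∑' I : Ideal (𝓞 L), ENNReal.ofReal ((Ideal.absNorm I : ℝ) ^ (-s))) := by
          gcongr
          exact hle s hs
      _ = _ := by ring)
  simp at hlim
  exact absurd hlim (dedekindZeta_residue_pos K).not_ge

theorem exists_quadratic_extension_sq_eq_neg_one (K : Type u) [Field K] [NumberField K]
    (hK : ∀ z : K, z ^ 2 ≠ -1) :
    ∃ (L : Type u) (_ : Field L) (_ : NumberField L) (_ : Algebra K L) (j : L) (σ : L →ₐ[K] L),
      Module.finrank K L = 2 ∧ j ^ 2 = -1 ∧ σ j = -j := by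
  have hirr : Irreducible (X ^ 2 - C (-1) : K[X]) :=
    X_pow_sub_C_irreducible_of_prime Nat.prime_two hK
  have := Fact.mk hirr
  have hdeg : (X ^ 2 - C (-1) : K[X]).natDegree = 2 := natDegree_X_pow_sub_C
  let L := AdjoinRoot (X ^ 2 - C (-1) : K[X])
  let pb := AdjoinRoot.powerBasis hirr.ne_zero
  have : FiniteDimensional K L := pb.finite
  have : NumberField L := NumberField.of_module_finite K L
  have hj : (AdjoinRoot.root (X ^ 2 - C (-1) : K[X])) ^ 2 = -1 := by
    have := AdjoinRoot.eval₂_root (X ^ 2 - C (-1) : K[X])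
    simp at this
    linear_combination this
  let σ : L →ₐ[K] L := AdjoinRoot.liftAlgHom _ (Algebra.ofId K L) (-AdjoinRoot.root _) (by
    simp [hj])
  refine ⟨L, inferInstance, inferInstance, inferInstance, AdjoinRoot.root _, σ, ?_, hj, ?_⟩
  · rw [pb.finrank, AdjoinRoot.powerBasis_dim, hdeg]
  · exact AdjoinRoot.liftAlgHom_root ..

end NumberField

theorem infinitely_many_degree_one_primes_three_mod_four
    (g : Polynomial ℤ) (hg : Irreducible g) (hdeg : 0 < g.natDegree)
    (K : Type) [Field K] [NumberField K] (x : K)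
    (hx : Polynomial.aeval x g = 0)
    (hgen : Algebra.adjoin ℚ {x} = ⊤)
    (hmu4 : ∀ z : K, z ^ 2 ≠ -1) :
    {p : ℕ | p.Prime ∧ p % 4 = 3 ∧
      ∃ P : Ideal (RingOfIntegers K), P.IsPrime ∧ P ≠ ⊥ ∧
        (p : RingOfIntegers K) ∈ P ∧ Nat.card (RingOfIntegers K ⧸ P) = p}.Infinite := by
  intro hfin
  obtain ⟨L, _, _, _, j, σ, h2, hj, hσ⟩ := exists_quadratic_extension_sq_eq_neg_one K hmu4
  refine infinite_setOf_absNorm_prime_mod_four_eq_three h2 hj σ hσ ?_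
  refine (hfin.preimage' (f := Ideal.absNorm (S := 𝓞 K))
    fun n _ ↦ Ideal.finite_setOfPred_absNorm_eq n).subset ?_
  rintro P ⟨hp, hp4⟩
  refine ⟨hp, hp4, P, Ideal.isPrime_of_irreducible_absNorm hp, ?_, Ideal.absNorm_mem P, rfl⟩
  rintro rfl
  simp at hp4
end
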